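/- Let H be a real inner product space, a₁, a₂ ∈ (0,1), and let T₁, T₂ : H → H be a₁-averaged and a₂-averaged respectively. Then the composition T₁ ∘ T₂ is a-averaged with a = (a₁ + a₂ − 2a₁a₂)/(1 − a₁a₂), i.e., there exists a nonexpansive N : H → H with T₁(T₂ x) = (1 − a)·x + a·N x for all x ∈ H. -/

import Mathlib

open RealInnerProductSpace

lemma avg_iff_aux {H : Type*} [NormedAddCommGroup H] [InnerProductSpace ℝ H]
    (a : ℝ) (ha : 0 < a) (d n w : H) (hw : w = (1 - a) • d + a • n) :
    ‖n‖ ≤ ‖d‖ ↔ a * ‖w‖ ^ 2 + (1 - a) * ‖w - d‖ ^ 2 ≤ a * ‖d‖ ^ 2 := by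
  have key : a * ‖w‖ ^ 2 + (1 - a) * ‖w - d‖ ^ 2
      = a * ‖d‖ ^ 2 + a ^ 2 * (‖n‖ ^ 2 - ‖d‖ ^ 2) := by
    subst hw
    simp only [← real_inner_self_eq_norm_sq, inner_add_left, inner_add_right, inner_sub_left,
      inner_sub_right, real_inner_smul_left, real_inner_smul_right, real_inner_comm d n]
    ring
  rw [key, ← sq_le_sq₀ (norm_nonneg n) (norm_nonneg d)]
  have h2 : 0 < a ^ 2 := by positivity
  constructor
  · intro h
    nlinarith
  · intro h
    by_contra hc
    push Not at hc
    have := mul_pos h2 (sub_pos.2 hc)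
    linarith

lemma comp_aux {H : Type*} [NormedAddCommGroup H] [InnerProductSpace ℝ H]
    (a b : ℝ) (ha : 0 < a) (hb : 0 < b) (ha1 : a < 1) (hb1 : b < 1) (d v w : H)
    (h2 : b * ‖v‖ ^ 2 + (1 - b) * ‖v - d‖ ^ 2 ≤ b * ‖d‖ ^ 2)
    (h1 : a * ‖w‖ ^ 2 + (1 - a) * ‖w - v‖ ^ 2 ≤ a * ‖v‖ ^ 2) :
    (a + b - 2 * a * b) * ‖w‖ ^ 2 + ((1 - a) * (1 - b)) * ‖w - d‖ ^ 2
      ≤ (a + b - 2 * a * b) * ‖d‖ ^ 2 := by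
  have hs : 0 < a + b - 2 * a * b := by nlinarith
  have e : (a + b - 2 * a * b) * (a * (1 - b) * ‖v - d‖ ^ 2 + b * (1 - a) * ‖w - v‖ ^ 2)
      - a * b * ((1 - a) * (1 - b)) * ‖w - d‖ ^ 2
      = ‖(a * (1 - b)) • (v - d) - (b * (1 - a)) • (w - v)‖ ^ 2 := by
    simp only [← real_inner_self_eq_norm_sq, inner_sub_left,
      inner_sub_right, real_inner_smul_left, real_inner_smul_right, real_inner_comm d v,
      real_inner_comm d w, real_inner_comm v w]
    ring
  have e0 := sq_nonneg ‖(a * (1 - b)) • (v - d) - (b * (1 - a)) • (w - v)‖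
  rw [← e] at e0
  have h3 : a * b * ‖w‖ ^ 2 + (a * (1 - b) * ‖v - d‖ ^ 2 + b * (1 - a) * ‖w - v‖ ^ 2)
      ≤ a * b * ‖d‖ ^ 2 := by
    have := mul_le_mul_of_nonneg_left h2 ha.le
    have := mul_le_mul_of_nonneg_left h1 hb.le
    linarith
  have h4 := mul_le_mul_of_nonneg_left h3 hs.le
  refine le_of_mul_le_mul_left ?_ (mul_pos ha hb)
  linarith

theorem stmt8 {H : Type*} [NormedAddCommGroup H] [InnerProductSpace ℝ H]
    (a₁ a₂ : ℝ) (ha₁ : a₁ ∈ Set.Ioo (0 : ℝ) 1) (ha₂ : a₂ ∈ Set.Ioo (0 : ℝ) 1)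
    (T₁ T₂ N₁ N₂ : H → H)
    (hN₁ : ∀ x y, ‖N₁ x - N₁ y‖ ≤ ‖x - y‖)
    (hN₂ : ∀ x y, ‖N₂ x - N₂ y‖ ≤ ‖x - y‖)
    (hT₁ : ∀ x, T₁ x = (1 - a₁) • x + a₁ • N₁ x)
    (hT₂ : ∀ x, T₂ x = (1 - a₂) • x + a₂ • N₂ x) :
    ∃ N : H → H, (∀ x y, ‖N x - N y‖ ≤ ‖x - y‖) ∧
      ∀ x, T₁ (T₂ x) = (1 - (a₁ + a₂ - 2 * a₁ * a₂) / (1 - a₁ * a₂)) • x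
        + ((a₁ + a₂ - 2 * a₁ * a₂) / (1 - a₁ * a₂)) • N x := by
  obtain ⟨ha, ha1⟩ := ha₁
  obtain ⟨hb, hb1⟩ := ha₂
  have hs : 0 < a₁ + a₂ - 2 * a₁ * a₂ := by nlinarith
  have ht : 0 < 1 - a₁ * a₂ := by nlinarith
  obtain ⟨c, hc⟩ : ∃ c, c = (a₁ + a₂ - 2 * a₁ * a₂) / (1 - a₁ * a₂) := ⟨_, rfl⟩
  rw [← hc]
  have hc0 : 0 < c := hc ▸ div_pos hs ht
  have hct : (1 - a₁ * a₂) * c = a₁ + a₂ - 2 * a₁ * a₂ := by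
    rw [hc]; field_simp
  have hN : ∀ x, T₁ (T₂ x) = (1 - c) • x + c • (c⁻¹ • (T₁ (T₂ x) - (1 - c) • x)) := by
    intro x
    rw [smul_inv_smul₀ hc0.ne']
    abel
  refine ⟨fun x => c⁻¹ • (T₁ (T₂ x) - (1 - c) • x), ?_, hN⟩
  intro x y
  have g2 := (avg_iff_aux a₂ hb (x - y) (N₂ x - N₂ y) (T₂ x - T₂ y)
    (by rw [hT₂, hT₂]; module)).1 (hN₂ x y)
  have g1 := (avg_iff_aux a₁ ha (T₂ x - T₂ y) (N₁ (T₂ x) - N₁ (T₂ y)) (T₁ (T₂ x) - T₁ (T₂ y))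
    (by rw [hT₁ (T₂ x), hT₁ (T₂ y)]; module)).1 (hN₁ _ _)
  have g := comp_aux a₁ a₂ ha hb ha1 hb1 _ _ _ g2 g1
  refine (avg_iff_aux c hc0 (x - y) _ (T₁ (T₂ x) - T₁ (T₂ y)) ?_).2 ?_
  · rw [smul_sub c, smul_inv_smul₀ hc0.ne', smul_inv_smul₀ hc0.ne']
    module
  · refine le_of_mul_le_mul_left ?_ ht
    have h1c : (1 - a₁) * (1 - a₂) = (1 - a₁ * a₂) * (1 - c) := by linarith
    rw [h1c, ← hct] at g
    linarith
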